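/- Let T be a basic functional in L(G(Ω),ℂ̃). For every k ∈ G(Ω×Ω) and every u ∈ G_c(Ω), T(∫_Ω k(x,·)u(x)dx) = ∫_Ω T(k(x,·))u(x)dx in ℂ̃, where ∫_Ω k(x,y)u(x)dx ∈ G(Ω) (in the variable y) has representative y ↦ ∫ k_ε(x,y)u_ε(x)dx, T(k(x,·)) ∈ G(Ω) has representative x ↦ T_ε(k_ε(x,·)), and the right-hand side is the generalized number with representative ∫ T_ε(k_ε(x,·))u_ε(x)dx. -/

import Mathlib

noncomputable section

open Set MeasureTheory Topology

/-- Euclidean space `ℝ^n`. -/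
abbrev Rn (n : ℕ) := EuclideanSpace ℝ (Fin n)

namespace Colombeau

/-- A net of smooth functions on the open set `Ω ⊆ E` is *moderate*:
for every compact `K ⊆ Ω` and derivative order `i` there is `N` with
`sup_{x∈K} ‖∂^i u_ε(x)‖ = O(ε^{-N})` as `ε → 0`. -/
def IsModerate {E : Type} [NormedAddCommGroup E] [NormedSpace ℝ E]
    (Ω : Set E) (u : ℝ → E → ℂ) : Prop :=
  (∀ ε ∈ Ioc (0:ℝ) 1, ContDiffOn ℝ (⊤ : ℕ∞) (u ε) Ω) ∧
  ∀ K : Set E, IsCompact K → K ⊆ Ω → ∀ i : ℕ,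
    ∃ N : ℕ, ∃ c > 0, ∃ η ∈ Ioc (0:ℝ) 1, ∀ ε ∈ Ioc (0:ℝ) η, ∀ x ∈ K,
      ‖iteratedFDeriv ℝ i (u ε) x‖ ≤ c * ε ^ (-(N:ℝ))

/-- A net of smooth functions on `Ω` is *negligible*:
for every compact `K ⊆ Ω`, derivative order `i` and every `q`,
`sup_{x∈K} ‖∂^i u_ε(x)‖ = O(ε^q)` as `ε → 0`. -/
def IsNegligible {E : Type} [NormedAddCommGroup E] [NormedSpace ℝ E]
    (Ω : Set E) (u : ℝ → E → ℂ) : Prop :=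
  (∀ ε ∈ Ioc (0:ℝ) 1, ContDiffOn ℝ (⊤ : ℕ∞) (u ε) Ω) ∧
  ∀ K : Set E, IsCompact K → K ⊆ Ω → ∀ i : ℕ, ∀ q : ℕ,
    ∃ c > 0, ∃ η ∈ Ioc (0:ℝ) 1, ∀ ε ∈ Ioc (0:ℝ) η, ∀ x ∈ K,
      ‖iteratedFDeriv ℝ i (u ε) x‖ ≤ c * ε ^ (q:ℝ)

/-- `G^∞`-moderateness: on each compact set the exponent `N` is uniform in the
derivative order. -/
def IsGinfModerate {E : Type} [NormedAddCommGroup E] [NormedSpace ℝ E]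
    (Ω : Set E) (u : ℝ → E → ℂ) : Prop :=
  (∀ ε ∈ Ioc (0:ℝ) 1, ContDiffOn ℝ (⊤ : ℕ∞) (u ε) Ω) ∧
  ∀ K : Set E, IsCompact K → K ⊆ Ω → ∃ N : ℕ, ∀ i : ℕ,
    ∃ c > 0, ∃ η ∈ Ioc (0:ℝ) 1, ∀ ε ∈ Ioc (0:ℝ) η, ∀ x ∈ K,
      ‖iteratedFDeriv ℝ i (u ε) x‖ ≤ c * ε ^ (-(N:ℝ))

/-- The net `u` has all its supports contained in one fixed compact subset of `Ω`. -/
def HasCmpSupp {E : Type} [NormedAddCommGroup E] [NormedSpace ℝ E]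
    (Ω : Set E) (u : ℝ → E → ℂ) : Prop :=
  ∃ K : Set E, IsCompact K ∧ K ⊆ Ω ∧ ∀ ε ∈ Ioc (0:ℝ) 1, tsupport (u ε) ⊆ K

/-- Moderate nets of complex numbers (representatives of elements of `ℂ̃`). -/
def CIsModerate (z : ℝ → ℂ) : Prop :=
  ∃ N : ℕ, ∃ c > 0, ∃ η ∈ Ioc (0:ℝ) 1, ∀ ε ∈ Ioc (0:ℝ) η, ‖z ε‖ ≤ c * ε ^ (-(N:ℝ))

/-- Negligible nets of complex numbers. -/
def CIsNegligible (z : ℝ → ℂ) : Prop :=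
  ∀ q : ℕ, ∃ c > 0, ∃ η ∈ Ioc (0:ℝ) 1, ∀ ε ∈ Ioc (0:ℝ) η, ‖z ε‖ ≤ c * ε ^ (q:ℝ)

/-- `S` is a distribution on `Ω`: for each compact `K ⊆ Ω` it is continuous with respect
to some seminorm `sup_{x∈K, |α|≤j} |∂^α f(x)|` on smooth functions supported in `K`. -/
def IsDistributionOn {n : ℕ} (Ω : Set (Rn n)) (S : (Rn n → ℂ) →ₗ[ℂ] ℂ) : Prop :=
  ∀ K : Set (Rn n), IsCompact K → K ⊆ Ω →
    ∃ j : ℕ, ∃ C : ℝ, 0 ≤ C ∧ ∀ f : Rn n → ℂ, ContDiffOn ℝ (⊤ : ℕ∞) f Ω → tsupport f ⊆ K →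
      ∀ B : ℝ, (∀ x ∈ K, ∀ i ≤ j, ‖iteratedFDeriv ℝ i f x‖ ≤ B) → ‖S f‖ ≤ C * B

/-- `S` is a compactly supported distribution on `Ω`. -/
def IsCptSuppDistributionOn {n : ℕ} (Ω : Set (Rn n)) (S : (Rn n → ℂ) →ₗ[ℂ] ℂ) : Prop :=
  ∃ K : Set (Rn n), IsCompact K ∧ K ⊆ Ω ∧
    ∃ j : ℕ, ∃ C : ℝ, 0 ≤ C ∧ ∀ f : Rn n → ℂ, ContDiffOn ℝ (⊤ : ℕ∞) f Ω →
      ∀ B : ℝ, (∀ x ∈ K, ∀ i ≤ j, ‖iteratedFDeriv ℝ i f x‖ ≤ B) → ‖S f‖ ≤ C * B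

/-- A net of distributions on `Ω` defining a *basic* functional on `G_c(Ω)`:
for every compact `K ⊆ Ω` there are `j`, `N`, `η ∈ (0,1]` with
`|T_ε(f)| ≤ ε^{-N} sup_{x∈K,|α|≤j} |∂^α f(x)|` for all smooth `f` supported in `K`
and all `ε ≤ η`. -/
def IsBasicNetC {n : ℕ} (Ω : Set (Rn n)) (T : ℝ → (Rn n → ℂ) →ₗ[ℂ] ℂ) : Prop :=
  (∀ ε ∈ Ioc (0:ℝ) 1, IsDistributionOn Ω (T ε)) ∧
  ∀ K : Set (Rn n), IsCompact K → K ⊆ Ω →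
    ∃ j N : ℕ, ∃ η ∈ Ioc (0:ℝ) 1, ∀ ε ∈ Ioc (0:ℝ) η,
      ∀ f : Rn n → ℂ, ContDiffOn ℝ (⊤ : ℕ∞) f Ω → tsupport f ⊆ K →
        ∀ C : ℝ, 0 ≤ C → (∀ x ∈ K, ∀ i ≤ j, ‖iteratedFDeriv ℝ i f x‖ ≤ C) →
          ‖T ε f‖ ≤ ε ^ (-(N:ℝ)) * C

/-- A net of compactly supported distributions on `Ω` defining a *basic* functional on
`G(Ω)`: there are a compact `K ⊆ Ω` and `j`, `N`, `η ∈ (0,1]` with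
`|T_ε(f)| ≤ ε^{-N} sup_{x∈K,|α|≤j} |∂^α f(x)|` for all `f ∈ C^∞(Ω)` and all `ε ≤ η`. -/
def IsBasicNetE {n : ℕ} (Ω : Set (Rn n)) (T : ℝ → (Rn n → ℂ) →ₗ[ℂ] ℂ) : Prop :=
  (∀ ε ∈ Ioc (0:ℝ) 1, IsCptSuppDistributionOn Ω (T ε)) ∧
  ∃ K : Set (Rn n), IsCompact K ∧ K ⊆ Ω ∧
    ∃ j N : ℕ, ∃ η ∈ Ioc (0:ℝ) 1, ∀ ε ∈ Ioc (0:ℝ) η,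
      ∀ f : Rn n → ℂ, ContDiffOn ℝ (⊤ : ℕ∞) f Ω →
        ∀ C : ℝ, 0 ≤ C → (∀ x ∈ K, ∀ i ≤ j, ‖iteratedFDeriv ℝ i f x‖ ≤ C) →
          ‖T ε f‖ ≤ ε ^ (-(N:ℝ)) * C

end Colombeau

open Colombeau

/-- The map `x ↦ g (x, ·)` with values in the continuous functions on `K`. -/
def sliceMap {E F V : Type} [TopologicalSpace E] [TopologicalSpace F]
    [TopologicalSpace V] (K : Set F) (g : C(E × F, V)) : C(E, C(K, V)) :=
  (g.comp ((ContinuousMap.id E).prodMap ⟨Subtype.val, continuous_subtype_val⟩)).curry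

@[simp]
theorem sliceMap_apply {E F V : Type} [TopologicalSpace E] [TopologicalSpace F]
    [TopologicalSpace V] (K : Set F) (g : C(E × F, V)) (x : E) (y : K) :
    sliceMap K g x y = g (x, y) := rfl

section Slices

variable {E F V : Type} [NormedAddCommGroup E] [NormedSpace ℝ E] [NormedAddCommGroup F]
  [NormedSpace ℝ F] [NormedAddCommGroup V] [NormedSpace ℝ V]

theorem iteratedFDeriv_slice_snd {g : E × F → V} (hg : ContDiff ℝ (⊤ : ℕ∞) g) (i : ℕ)
    (x : E) (y : F) :
    iteratedFDeriv ℝ i (fun z => g (x, z)) y =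
      (iteratedFDeriv ℝ i g (x, y)).compContinuousLinearMap
        fun _ => ContinuousLinearMap.inr ℝ E F := by
  have h := (ContinuousLinearMap.inr ℝ E F).iteratedFDeriv_comp_right
    (f := fun p => g ((x, 0) + p)) (hg.comp (contDiff_const.add contDiff_id)) y
    (i := i) (mod_cast le_top)
  simpa [Function.comp_def, iteratedFDeriv_comp_add_left] using h

theorem iteratedFDeriv_slice_fst {g : E × F → V} (hg : ContDiff ℝ (⊤ : ℕ∞) g) (i : ℕ)
    (x : E) (y : F) :
    iteratedFDeriv ℝ i (fun z => g (z, y)) x =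
      (iteratedFDeriv ℝ i g (x, y)).compContinuousLinearMap
        fun _ => ContinuousLinearMap.inl ℝ E F := by
  have h := (ContinuousLinearMap.inl ℝ E F).iteratedFDeriv_comp_right
    (f := fun p => g ((0, y) + p)) (hg.comp (contDiff_const.add contDiff_id)) x
    (i := i) (mod_cast le_top)
  simpa [Function.comp_def, iteratedFDeriv_comp_add_left] using h

theorem norm_iteratedFDeriv_slice_snd_le {g : E × F → V} (hg : ContDiff ℝ (⊤ : ℕ∞) g) (i : ℕ)
    (x : E) (y : F) :
    ‖iteratedFDeriv ℝ i (fun z => g (x, z)) y‖ ≤ ‖iteratedFDeriv ℝ i g (x, y)‖ := by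
  rw [iteratedFDeriv_slice_snd hg]
  refine (ContinuousMultilinearMap.norm_compContinuousLinearMap_le _ _).trans
    (mul_le_of_le_one_right (norm_nonneg _) ?_)
  exact Finset.prod_le_one (fun _ _ => norm_nonneg _)
    fun _ _ => ContinuousLinearMap.norm_inr_le_one ℝ E F

theorem norm_iteratedFDeriv_slice_fst_le {g : E × F → V} (hg : ContDiff ℝ (⊤ : ℕ∞) g) (i : ℕ)
    (x : E) (y : F) :
    ‖iteratedFDeriv ℝ i (fun z => g (z, y)) x‖ ≤ ‖iteratedFDeriv ℝ i g (x, y)‖ := by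
  rw [iteratedFDeriv_slice_fst hg]
  refine (ContinuousMultilinearMap.norm_compContinuousLinearMap_le _ _).trans
    (mul_le_of_le_one_right (norm_nonneg _) ?_)
  exact Finset.prod_le_one (fun _ _ => norm_nonneg _)
    fun _ _ => ContinuousLinearMap.norm_inl_le_one ℝ E F

theorem norm_iteratedFDeriv_iteratedFDeriv (g : E → V) (i l : ℕ) (x : E) :
    ‖iteratedFDeriv ℝ i (iteratedFDeriv ℝ l g) x‖ = ‖iteratedFDeriv ℝ (i + l) g x‖ := by
  induction l generalizing i with
  | zero =>
    rw [iteratedFDeriv_zero_eq_comp, LinearIsometryEquiv.norm_iteratedFDeriv_comp_left, add_zero]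
  | succ l ih =>
    let e : (E →L[ℝ] (E [×l]→L[ℝ] V)) ≃ₗᵢ[ℝ] (E [×(l + 1)]→L[ℝ] V) :=
      (continuousMultilinearCurryLeftEquiv ℝ (fun _ : Fin (l + 1) => E) V).symm
    have h : iteratedFDeriv ℝ (l + 1) g = e ∘ fderiv ℝ (iteratedFDeriv ℝ l g) :=
      iteratedFDeriv_succ_eq_comp_left
    rw [h, LinearIsometryEquiv.norm_iteratedFDeriv_comp_left (𝕜 := ℝ) (F := E →L[ℝ] E [×l]→L[ℝ] V)
      (G := E [×(l + 1)]→L[ℝ] V) e, norm_iteratedFDeriv_fderiv, ih, add_right_comm, add_assoc]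

/-- Mixed partial derivatives are bounded by the full derivative of the total order. -/
theorem norm_iteratedFDeriv_iteratedFDeriv_slice_le {g : E × F → V}
    (hg : ContDiff ℝ (⊤ : ℕ∞) g) (i l : ℕ) (x : E) (y : F) :
    ‖iteratedFDeriv ℝ i (fun z => iteratedFDeriv ℝ l (fun w => g (z, w)) y) x‖ ≤
      ‖iteratedFDeriv ℝ (i + l) g (x, y)‖ := by
  have hQ : ContDiff ℝ (⊤ : ℕ∞) (iteratedFDeriv ℝ l g) :=
    hg.iteratedFDeriv_right (by norm_cast)
  let P : ((E × F) [×l]→L[ℝ] V) →L[ℝ] (F [×l]→L[ℝ] V) :=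
    ContinuousMultilinearMap.compContinuousLinearMapL
      fun _ : Fin l => ContinuousLinearMap.inr ℝ E F
  have hP : ‖P‖ ≤ 1 := (ContinuousMultilinearMap.norm_compContinuousLinearMapL_le _ _).trans
    (Finset.prod_le_one (fun _ _ => norm_nonneg _)
      fun _ _ => ContinuousLinearMap.norm_inr_le_one ℝ E F)
  have h : (fun z => iteratedFDeriv ℝ l (fun w => g (z, w)) y) =
      P ∘ fun z => iteratedFDeriv ℝ l g (z, y) := by
    ext1 z
    exact iteratedFDeriv_slice_snd hg l z y
  rw [h]
  have hs : ContDiff ℝ (⊤ : ℕ∞) fun z => iteratedFDeriv ℝ l g (z, y) :=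
    hQ.comp (contDiff_id.prodMk contDiff_const)
  calc _ ≤ ‖P‖ * ‖iteratedFDeriv ℝ i (fun z => iteratedFDeriv ℝ l g (z, y)) x‖ :=
        P.norm_iteratedFDeriv_comp_left hs.contDiffAt (mod_cast le_top)
    _ ≤ ‖iteratedFDeriv ℝ i (fun z => iteratedFDeriv ℝ l g (z, y)) x‖ :=
        mul_le_of_le_one_left (norm_nonneg _) hP
    _ ≤ _ := norm_iteratedFDeriv_slice_fst_le hQ i x y
    _ = _ := norm_iteratedFDeriv_iteratedFDeriv g i l (x, y)

variable {K : Set F} [CompactSpace K]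

/-- A continuous family of linear maps as a linear map into continuous functions. -/
def flipCLM (K : Set F) [CompactSpace K] : C(K, E →L[ℝ] V) →L[ℝ] E →L[ℝ] C(K, V) :=
  LinearMap.mkContinuous₂
    (LinearMap.mk₂ ℝ
      (fun (f : C(K, E →L[ℝ] V)) (w : E) => (⟨fun y => f y w, by fun_prop⟩ : C(K, V)))
      (fun _ _ _ => rfl) (fun _ _ _ => rfl)
      (fun f w w' => by ext y; exact map_add (f y) w w')
      (fun c f w => by ext y; exact map_smul (f y) c w)) 1 (by
    intro f w
    rw [ContinuousMap.norm_le _ (by positivity), one_mul]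
    exact fun y => (f y).le_of_opNorm_le (f.norm_coe_le_norm y) w)

omit [NormedSpace ℝ F] in
@[simp]
theorem flipCLM_apply (f : C(K, E →L[ℝ] V)) (w : E) (y : K) : flipCLM K f w y = f y w := rfl

theorem contDiff_fderiv_fst {g : E × F → V} (hg : ContDiff ℝ (⊤ : ℕ∞) g) :
    ContDiff ℝ (⊤ : ℕ∞) fun p => (fderiv ℝ g p).comp (ContinuousLinearMap.inl ℝ E F) :=
  (hg.fderiv_right (by norm_cast)).clm_comp contDiff_const

theorem hasFDerivAt_sliceMap (g : C(E × F, V)) (hg : ContDiff ℝ (⊤ : ℕ∞) g) (x : E) :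
    HasFDerivAt (sliceMap K g)
      (flipCLM K (sliceMap K ⟨_, (contDiff_fderiv_fst hg).continuous⟩ x)) x := by
  set G : C(E × F, E →L[ℝ] V) := ⟨_, (contDiff_fderiv_fst hg).continuous⟩
  rw [hasFDerivAt_iff_isLittleO, Asymptotics.isLittleO_iff]
  intro c hc
  obtain ⟨δ, hδ, hG⟩ := (Metric.continuous_iff (β := C(K, E →L[ℝ] V))).1
    (sliceMap K G).continuous x c hc
  filter_upwards [Metric.ball_mem_nhds x hδ] with x' hx'
  rw [ContinuousMap.norm_le _ (by positivity)]
  intro y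
  have hd : ∀ z ∈ Metric.ball x δ,
      HasFDerivWithinAt (fun z => g (z, (y : F))) (G (z, y)) (Metric.ball x δ) z := fun z _ =>
    (((hg.differentiable (by simp)) (z, (y : F))).hasFDerivAt.comp z
      (hasFDerivAt_prodMk_left z (y : F))).hasFDerivWithinAt
  exact (convex_ball x δ).norm_image_sub_le_of_norm_hasFDerivWithin_le' hd
    (fun z hz => by
      have h := ((sliceMap K G z - sliceMap K G x).norm_coe_le_norm y).trans
        ((dist_eq_norm _ _).symm.trans_le (hG z hz).le)
      simpa using h)
    (Metric.mem_ball_self hδ) hx'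

theorem contDiff_sliceMap (g : C(E × F, V)) (hg : ContDiff ℝ (⊤ : ℕ∞) g) :
    ContDiff ℝ (⊤ : ℕ∞) (sliceMap K g) := by
  have key : ∀ (m : ℕ) (V : Type) [NormedAddCommGroup V] [NormedSpace ℝ V] (g : C(E × F, V)),
      ContDiff ℝ (⊤ : ℕ∞) g → ContDiff ℝ m (sliceMap K g) := by
    intro m
    induction m with
    | zero => exact fun V _ _ g _ => contDiff_zero.2 (sliceMap K g).continuous
    | succ m ih =>
      intro V _ _ g hg
      rw [Nat.cast_succ, contDiff_succ_iff_hasFDerivAt]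
      exact ⟨_, (flipCLM K).contDiff.comp (ih _ ⟨_, (contDiff_fderiv_fst hg).continuous⟩
        (contDiff_fderiv_fst hg)), hasFDerivAt_sliceMap g hg⟩
  exact contDiff_infty.2 fun m => key m V g hg

theorem iteratedFDeriv_sliceMap_apply (g : C(E × F, V)) (hg : ContDiff ℝ (⊤ : ℕ∞) g) (i : ℕ)
    (x : E) (w : Fin i → E) (y : K) :
    iteratedFDeriv ℝ i (sliceMap K g) x w y =
      iteratedFDeriv ℝ i (fun z => g (z, (y : F))) x w := by
  have h := (ContinuousMap.evalCLM (M := V) ℝ y).iteratedFDeriv_comp_left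
    (contDiff_sliceMap (K := K) g hg).contDiffAt (x := x) (i := i) (mod_cast le_top)
  exact (congr($h w)).symm

end Slices

section Cutoff

/-- A function which is smooth on an open set agrees near a compact subset with a globally smooth
function. -/
theorem exists_contDiff_eventuallyEq_nhdsSet {E V : Type*} [NormedAddCommGroup E]
    [NormedSpace ℝ E] [FiniteDimensional ℝ E] [NormedAddCommGroup V] [NormedSpace ℝ V]
    {U K : Set E} (hU : IsOpen U) (hK : IsCompact K) (hKU : K ⊆ U) {f : E → V}
    (hf : ContDiffOn ℝ (⊤ : ℕ∞) f U) :
    ∃ g : E → V, ContDiff ℝ (⊤ : ℕ∞) g ∧ ∀ᶠ x in 𝓝ˢ K, f x = g x := by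
  obtain ⟨t, ht, hKt, htU⟩ := exists_compact_between hK hU hKU
  obtain ⟨χ, hχ1, hχ0, -⟩ := exists_contMDiffMap_one_nhds_of_subset_interior
    (n := (⊤ : ℕ∞)) (modelWithCornersSelf ℝ E) hK.isClosed hKt
  have hχ : ContDiff ℝ (⊤ : ℕ∞) χ := χ.contMDiff.contDiff
  refine ⟨fun x => χ x • f x, contDiff_iff_contDiffAt.2 fun x => ?_, ?_⟩
  · by_cases hx : x ∈ U
    · exact hχ.contDiffAt.smul (hf.contDiffAt (hU.mem_nhds hx))
    · refine (contDiffAt_const (c := (0 : V))).congr_of_eventuallyEq ?_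
      filter_upwards [ht.isClosed.isOpen_compl.mem_nhds fun h => hx (htU h)] with z hz
      simp [hχ0 z hz]
  · filter_upwards [hχ1] with x hx
    simp [hx]

end Cutoff

section ParametricIntegral

variable {E F : Type} [NormedAddCommGroup E] [NormedSpace ℝ E] [MeasurableSpace E]
  [BorelSpace E] [NormedAddCommGroup F] [NormedSpace ℝ F] {μ : Measure E} {L : Set E}
  {u : E → ℂ} {h : E × F → ℂ}

omit [NormedSpace ℝ E] in
theorem exists_clm_eq_setIntegral_mul (hL : IsCompact L) (hu : IntegrableOn u L μ) :
    ∃ I : C(L, ℂ) →L[ℝ] ℂ, ∀ (f : C(L, ℂ)) (f' : E → ℂ), (∀ x : L, f x = f' x) →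
      I f = ∫ x in L, f' x * u x ∂μ := by
  have hm : MeasurableSet L := hL.isClosed.measurableSet
  have : CompactSpace L := isCompact_iff_compactSpace.1 hL
  have hu' : Integrable (fun x : L => u x) (μ.comap Subtype.val) :=
    (integrableOn_iff_comap_subtypeVal hm).1 hu
  have hfu : ∀ f : C(L, ℂ), Integrable (fun x : L => f x * u x) (μ.comap Subtype.val) :=
    fun f => hu'.bdd_mul f.continuous.aestronglyMeasurable
      (Filter.Eventually.of_forall f.norm_coe_le_norm)
  refine ⟨LinearMap.mkContinuous
    { toFun := fun f => ∫ x : L, f x * u x ∂(μ.comap Subtype.val)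
      map_add' := fun f g => by
        simp only [ContinuousMap.add_apply, add_mul]
        exact integral_add (hfu f) (hfu g)
      map_smul' := fun c f => by
        simp only [ContinuousMap.smul_apply, smul_mul_assoc, RingHom.id_apply]
        exact integral_smul c _ }
    (∫ x : L, ‖u x‖ ∂(μ.comap Subtype.val)) fun f => ?_, fun f f' hff' => ?_⟩
  · refine (norm_integral_le_of_norm_le (hu'.norm.mul_const ‖f‖)
      (Filter.Eventually.of_forall fun x => ?_)).trans (integral_mul_const _ _).le
    rw [norm_mul, mul_comm]
    gcongr
    exact f.norm_coe_le_norm x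
  · simp only [LinearMap.mkContinuous_apply, LinearMap.coe_mk, AddHom.coe_mk, hff']
    exact integral_subtype_comap hm fun x => f' x * u x

/-- Smoothness of, and differentiation under the integral sign for, an integral over a compact set
depending smoothly on a parameter. -/
theorem contDiff_setIntegral_mul (hL : IsCompact L) (hu : IntegrableOn u L μ)
    (hh : ContDiff ℝ (⊤ : ℕ∞) h) :
    ContDiff ℝ (⊤ : ℕ∞) (fun y => ∫ x in L, h (x, y) * u x ∂μ) ∧
      ∀ (i : ℕ) (y : F) (w : Fin i → F),
        iteratedFDeriv ℝ i (fun y => ∫ x in L, h (x, y) * u x ∂μ) y w =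
          ∫ x in L, iteratedFDeriv ℝ i (fun z => h (x, z)) y w * u x ∂μ := by
  have : CompactSpace L := isCompact_iff_compactSpace.1 hL
  obtain ⟨I, hI⟩ := exists_clm_eq_setIntegral_mul hL hu
  have hs : ContDiff ℝ (⊤ : ℕ∞) fun p : F × E => h p.swap :=
    hh.comp (contDiff_snd.prodMk contDiff_fst)
  let g : C(F × E, ℂ) := ⟨_, hs.continuous⟩
  have hg := contDiff_sliceMap (K := L) g hs
  have hF : (fun y => ∫ x in L, h (x, y) * u x ∂μ) = I ∘ sliceMap L g := by
    ext1 y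
    exact (hI (sliceMap L g y) (fun x => h (x, y)) fun x => rfl).symm
  rw [hF]
  refine ⟨I.contDiff.comp hg, fun i y w => ?_⟩
  rw [I.iteratedFDeriv_comp_left hg.contDiffAt (mod_cast le_top)]
  exact hI _ _ fun x => iteratedFDeriv_sliceMap_apply g hs i y w x

theorem norm_iteratedFDeriv_setIntegral_mul_le (hL : IsCompact L) (hu : IntegrableOn u L μ)
    (hh : ContDiff ℝ (⊤ : ℕ∞) h) {i : ℕ} {y : F} {B : ℝ}
    (hB : 0 ≤ B) (hhB : ∀ x ∈ L, ‖iteratedFDeriv ℝ i h (x, y)‖ ≤ B) :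
    ‖iteratedFDeriv ℝ i (fun y => ∫ x in L, h (x, y) * u x ∂μ) y‖ ≤
      B * ∫ x in L, ‖u x‖ ∂μ := by
  refine ContinuousMultilinearMap.opNorm_le_bound (by positivity) fun w => ?_
  rw [(contDiff_setIntegral_mul hL hu hh).2, mul_right_comm, ← integral_const_mul]
  refine norm_integral_le_of_norm_le (hu.norm.const_mul _)
    (ae_restrict_of_forall_mem hL.isClosed.measurableSet fun x hx => ?_)
  rw [norm_mul]
  gcongr
  exact ContinuousMultilinearMap.le_of_opNorm_le
    ((norm_iteratedFDeriv_slice_snd_le hh i x y).trans (hhB x hx)) w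

end ParametricIntegral

/-- Hahn–Banach extension of a functional dominated by the norm of a linear map. -/
theorem exists_clm_comp_eq {W X : Type*} [AddCommGroup W] [Module ℂ W] [NormedAddCommGroup X]
    [NormedSpace ℂ X] {C : ℝ} (hC : 0 ≤ C) (J : W →ₗ[ℂ] X) (S : W →ₗ[ℂ] ℂ)
    (h : ∀ w, ‖S w‖ ≤ C * ‖J w‖) :
    ∃ Λ : X →L[ℂ] ℂ, ‖Λ‖ ≤ C ∧ ∀ w, Λ (J w) = S w := by
  have hker : LinearMap.ker J ≤ LinearMap.ker S := fun w hw => by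
    have := h w
    rw [LinearMap.mem_ker.1 hw, norm_zero, mul_zero] at this
    exact norm_le_zero_iff.1 this
  let Λ₀ : LinearMap.range J →ₗ[ℂ] ℂ :=
    ((LinearMap.ker J).liftQ S hker).comp J.quotKerEquivRange.symm.toLinearMap
  have hΛ₀ : ∀ w, Λ₀ ⟨J w, LinearMap.mem_range_self J w⟩ = S w := fun w => by
    have : J.quotKerEquivRange.symm ⟨J w, LinearMap.mem_range_self J w⟩ =
        (LinearMap.ker J).mkQ w := by
      rw [LinearEquiv.symm_apply_eq]; rfl
    simp [Λ₀, this]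
  have hbd : ∀ g, ‖Λ₀ g‖ ≤ C * ‖g‖ := by
    rintro ⟨_, w, rfl⟩
    rw [hΛ₀]
    exact h w
  obtain ⟨Λ, hΛ, hn⟩ := exists_extension_norm_eq _ (Λ₀.mkContinuous C hbd)
  refine ⟨Λ, hn.trans_le (Λ₀.mkContinuous_norm_le hC hbd), fun w => ?_⟩
  rw [← hΛ₀]
  exact hΛ ⟨J w, LinearMap.mem_range_self J w⟩

section Jets

variable {E F : Type} [NormedAddCommGroup E] [NormedSpace ℝ E] [NormedAddCommGroup F]
  [NormedSpace ℝ F]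

/-- The space of `j`-jets at a point of complex functions on `F`. -/
def JetSpace (F : Type) [NormedAddCommGroup F] [NormedSpace ℝ F] (j : ℕ) : Type :=
  (l : Fin (j + 1)) → F [×(l : ℕ)]→L[ℝ] ℂ

instance (j : ℕ) : NormedAddCommGroup (JetSpace F j) :=
  inferInstanceAs (NormedAddCommGroup ((l : Fin (j + 1)) → F [×(l : ℕ)]→L[ℝ] ℂ))

instance (j : ℕ) : NormedSpace ℝ (JetSpace F j) :=
  inferInstanceAs (NormedSpace ℝ ((l : Fin (j + 1)) → F [×(l : ℕ)]→L[ℝ] ℂ))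

instance (j : ℕ) : NormedSpace ℂ (JetSpace F j) :=
  inferInstanceAs (NormedSpace ℂ ((l : Fin (j + 1)) → F [×(l : ℕ)]→L[ℝ] ℂ))

instance (j : ℕ) : IsScalarTower ℝ ℂ (JetSpace F j) :=
  inferInstanceAs (IsScalarTower ℝ ℂ ((l : Fin (j + 1)) → F [×(l : ℕ)]→L[ℝ] ℂ))

instance (j : ℕ) : CompleteSpace (JetSpace F j) :=
  inferInstanceAs (CompleteSpace ((l : Fin (j + 1)) → F [×(l : ℕ)]→L[ℝ] ℂ))

/-- The component of order `l` of a jet. -/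
def JetSpace.proj {j : ℕ} (l : Fin (j + 1)) : JetSpace F j →L[ℝ] (F [×(l : ℕ)]→L[ℝ] ℂ) :=
  ContinuousLinearMap.proj (R := ℝ) (φ := fun l : Fin (j + 1) => F [×(l : ℕ)]→L[ℝ] ℂ) l

theorem JetSpace.norm_le_iff {j : ℕ} {v : JetSpace F j} {r : ℝ} (hr : 0 ≤ r) :
    ‖v‖ ≤ r ↔ ∀ l, ‖JetSpace.proj l v‖ ≤ r :=
  pi_norm_le_iff_of_nonneg hr

/-- The tuple of the derivatives of order at most `j` of `f` at `y`. -/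
def jet (j : ℕ) (f : F → ℂ) (y : F) : JetSpace F j :=
  fun l => iteratedFDeriv ℝ l f y

theorem jet_add (j : ℕ) {f g : F → ℂ} (hf : ContDiff ℝ (⊤ : ℕ∞) f) (hg : ContDiff ℝ (⊤ : ℕ∞) g)
    (y : F) : jet j (f + g) y = jet j f y + jet j g y :=
  funext fun _ => iteratedFDeriv_add_apply (hf.contDiffAt.of_le (mod_cast le_top))
    (hg.contDiffAt.of_le (mod_cast le_top))

theorem jet_const_smul (j : ℕ) (c : ℂ) {f : F → ℂ} (hf : ContDiff ℝ (⊤ : ℕ∞) f) (y : F) :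
    jet j (c • f) y = c • jet j f y :=
  funext fun _ => iteratedFDeriv_const_smul_apply (hf.contDiffAt.of_le (mod_cast le_top))

theorem norm_iteratedFDeriv_le_norm_jet {j i : ℕ} (hi : i ≤ j) (f : F → ℂ) (y : F) :
    ‖iteratedFDeriv ℝ i f y‖ ≤ ‖jet j f y‖ :=
  (JetSpace.norm_le_iff (v := jet j f y) (norm_nonneg _)).1 le_rfl ⟨i, Nat.lt_succ_of_le hi⟩

theorem contDiff_jet_slice (j : ℕ) {h : E × F → ℂ} (hh : ContDiff ℝ (⊤ : ℕ∞) h) :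
    ContDiff ℝ (⊤ : ℕ∞) fun p : E × F => jet j (fun z => h (p.1, z)) p.2 := by
  refine contDiff_pi.2 fun l => ?_
  simp only [jet, iteratedFDeriv_slice_snd hh]
  exact (ContinuousMultilinearMap.compContinuousLinearMapL (𝕜 := ℝ) (F := ℂ)
    fun _ : Fin l => ContinuousLinearMap.inr ℝ E F).contDiff.comp
      (hh.iteratedFDeriv_right (m := (⊤ : ℕ∞)) (by norm_cast))

theorem continuous_jet (j : ℕ) {f : F → ℂ} (hf : ContDiff ℝ (⊤ : ℕ∞) f) :
    Continuous (jet j f) :=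
  continuous_pi fun _ => hf.continuous_iteratedFDeriv (mod_cast le_top)

variable {S : (F → ℂ) →ₗ[ℂ] ℂ} {K : Set F} [CompactSpace K] {j : ℕ} {C : ℝ}

/-- A functional bounded by the `C^j` seminorm on `K` factors, with the same bound, through the
restriction to `K` of the `j`-jet. -/
theorem exists_clm_jet (hC : 0 ≤ C)
    (hS : ∀ f, ContDiff ℝ (⊤ : ℕ∞) f → ∀ B, 0 ≤ B →
      (∀ x ∈ K, ∀ i ≤ j, ‖iteratedFDeriv ℝ i f x‖ ≤ B) → ‖S f‖ ≤ C * B) :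
    ∃ Λ : C(K, JetSpace F j) →L[ℂ] ℂ, ‖Λ‖ ≤ C ∧
      ∀ f : F → ℂ, ContDiff ℝ (⊤ : ℕ∞) f →
        ∀ g : C(K, JetSpace F j), (∀ y : K, g y = jet j f y) →
          Λ g = S f := by
  let W : Submodule ℂ (F → ℂ) :=
    { carrier := {f | ContDiff ℝ (⊤ : ℕ∞) f}
      add_mem' := fun {f g} (hf : ContDiff ℝ (⊤ : ℕ∞) f) (hg : ContDiff ℝ (⊤ : ℕ∞) g) => hf.add hg
      zero_mem' := (contDiff_const : ContDiff ℝ (⊤ : ℕ∞) fun _ : F => (0 : ℂ))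
      smul_mem' := fun c f (hf : ContDiff ℝ (⊤ : ℕ∞) f) => hf.const_smul c }
  have hW : ∀ f : W, ContDiff ℝ (⊤ : ℕ∞) f.1 := fun f => f.2
  let J : W →ₗ[ℂ] C(K, JetSpace F j) :=
    { toFun := fun f => ⟨fun y => jet j f.1 y, (continuous_jet j (hW f)).comp continuous_subtype_val⟩
      map_add' := fun f g => ContinuousMap.ext fun y => jet_add j (hW f) (hW g) y
      map_smul' := fun c f => ContinuousMap.ext fun y => jet_const_smul j c (hW f) y }
  have hJ : ∀ f : W, ‖S f‖ ≤ C * ‖J f‖ := fun f => hS f (hW f) _ (norm_nonneg _) fun x hx i hi =>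
    (norm_iteratedFDeriv_le_norm_jet hi f.1 x).trans ((J f).norm_coe_le_norm ⟨x, hx⟩)
  obtain ⟨Λ, hn, hΛ⟩ := exists_clm_comp_eq hC J (S.comp W.subtype) hJ
  refine ⟨Λ, hn, fun f hf g hg => ?_⟩
  have : g = J ⟨f, hf⟩ := ContinuousMap.ext hg
  rw [this]
  exact hΛ ⟨f, hf⟩

variable {h : E × F → ℂ}

/-- Applying a distribution to a smooth family of functions gives a smooth function. -/
theorem contDiff_apply_slice (hC : 0 ≤ C)
    (hS : ∀ f, ContDiff ℝ (⊤ : ℕ∞) f → ∀ B, 0 ≤ B →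
      (∀ x ∈ K, ∀ i ≤ j, ‖iteratedFDeriv ℝ i f x‖ ≤ B) → ‖S f‖ ≤ C * B)
    (hh : ContDiff ℝ (⊤ : ℕ∞) h) :
    ContDiff ℝ (⊤ : ℕ∞) (fun x => S fun y => h (x, y)) ∧
      ∀ (i : ℕ) (x : E) (B : ℝ), 0 ≤ B →
        (∀ y ∈ K, ∀ l ≤ j, ‖iteratedFDeriv ℝ (i + l) h (x, y)‖ ≤ B) →
          ‖iteratedFDeriv ℝ i (fun x => S fun y => h (x, y)) x‖ ≤ C * B := by
  obtain ⟨Λ, hΛ, hΛS⟩ := exists_clm_jet hC hS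
  have hj := contDiff_jet_slice j hh
  let g : C(E × F, JetSpace F j) := ⟨_, hj.continuous⟩
  have hg := contDiff_sliceMap (K := K) g hj
  have hF : (fun x => S fun y => h (x, y)) = Λ.restrictScalars ℝ ∘ sliceMap K g := by
    ext1 x
    exact (hΛS _ (hh.comp (contDiff_const.prodMk contDiff_id)) _ fun y => rfl).symm
  rw [hF]
  refine ⟨(Λ.restrictScalars ℝ).contDiff.comp hg, fun i x B hB hhB => ?_⟩
  refine ((Λ.restrictScalars ℝ).norm_iteratedFDeriv_comp_left hg.contDiffAt
    (mod_cast le_top)).trans ?_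
  rw [ContinuousLinearMap.norm_restrictScalars]
  gcongr
  refine ContinuousMultilinearMap.opNorm_le_bound hB fun w => ?_
  rw [ContinuousMap.norm_le _ (by positivity)]
  intro y
  rw [iteratedFDeriv_sliceMap_apply g hj, JetSpace.norm_le_iff (by positivity)]
  intro l
  have hl := (JetSpace.proj l).iteratedFDeriv_comp_left
    (f := fun z => g (z, (y : F))) (x := x) (i := i) (n := (⊤ : ℕ∞))
    (hj.comp (contDiff_id.prodMk contDiff_const)).contDiffAt (mod_cast le_top)
  refine (congr(‖$hl w‖)).symm.le.trans (ContinuousMultilinearMap.le_of_opNorm_le ?_ w)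
  exact (norm_iteratedFDeriv_iteratedFDeriv_slice_le hh i l x y).trans
    (hhB y y.2 l (Nat.le_of_lt_succ l.2))

/-- Distributions commute with integrals over compact sets of smooth families of functions. -/
theorem apply_setIntegral_mul [MeasurableSpace E] [BorelSpace E] {μ : Measure E}
    [IsFiniteMeasureOnCompacts μ] {L : Set E} (hL : IsCompact L) {u : E → ℂ}
    (hu : ContinuousOn u L) (hC : 0 ≤ C)
    (hS : ∀ f, ContDiff ℝ (⊤ : ℕ∞) f → ∀ B, 0 ≤ B →
      (∀ x ∈ K, ∀ i ≤ j, ‖iteratedFDeriv ℝ i f x‖ ≤ B) → ‖S f‖ ≤ C * B)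
    (hh : ContDiff ℝ (⊤ : ℕ∞) h) :
    (S fun y => ∫ x in L, h (x, y) * u x ∂μ) = ∫ x in L, (S fun y => h (x, y)) * u x ∂μ := by
  obtain ⟨Λ, -, hΛS⟩ := exists_clm_jet hC hS
  have hj := contDiff_jet_slice j hh
  let g : C(E × F, JetSpace F j) := ⟨_, hj.continuous⟩
  have hui : IntegrableOn u L μ := hu.integrableOn_compact hL
  have hint : IntegrableOn (fun x => u x • sliceMap K g x) L μ :=
    (hu.smul (sliceMap K g).continuous.continuousOn).integrableOn_compact hL
  obtain ⟨hF, hFi⟩ := contDiff_setIntegral_mul hL hui hh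
  rw [← hΛS _ hF (∫ x in L, u x • sliceMap K g x ∂μ), ← Λ.integral_comp_comm hint]
  · congr 1
    ext1 x
    rw [map_smul, hΛS _ (hh.comp (contDiff_const.prodMk contDiff_id)) _ fun y => rfl, smul_eq_mul,
      mul_comm]
    rfl
  · intro y
    funext l
    ext w
    rw [jet, hFi]
    let ev : C(K, JetSpace F j) →L[ℝ] ℂ :=
      (ContinuousMultilinearMap.apply ℝ (fun _ : Fin (l : ℕ) => F) ℂ w).comp
        ((JetSpace.proj l).comp (ContinuousMap.evalCLM ℝ y))
    refine (ev.integral_comp_comm hint).symm.trans ?_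
    congr 1
    ext1 x
    exact mul_comm _ _

end Jets

section Localization

variable {E F : Type} [NormedAddCommGroup E] [NormedSpace ℝ E] [FiniteDimensional ℝ E]
  [NormedAddCommGroup F] [NormedSpace ℝ F] [FiniteDimensional ℝ F]
  {Ω K L : Set E} {Ω' K' : Set F}

theorem exists_contDiff_eq_on_prod {k : E × F → ℂ} (hΩ : IsOpen Ω) (hΩ' : IsOpen Ω')
    (hK : IsCompact K) (hKΩ : K ⊆ Ω) (hK' : IsCompact K') (hKΩ' : K' ⊆ Ω')
    (hk : ContDiffOn ℝ (⊤ : ℕ∞) k (Ω ×ˢ Ω')) :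
    ∃ h : E × F → ℂ, ContDiff ℝ (⊤ : ℕ∞) h ∧ ∃ U ⊆ Ω, ∃ U' ⊆ Ω', IsOpen U ∧ IsOpen U' ∧
      K ⊆ U ∧ K' ⊆ U' ∧ ∀ x ∈ U, ∀ y ∈ U', k (x, y) = h (x, y) := by
  obtain ⟨h, hh, hkh⟩ := exists_contDiff_eventuallyEq_nhdsSet (hΩ.prod hΩ') (hK.prod hK')
    (prod_mono hKΩ hKΩ') hk
  obtain ⟨W, hW, hKW, hWe⟩ := eventually_nhdsSet_iff_exists.1 hkh
  obtain ⟨U, U', hU, hU', hKU, hKU', hUW⟩ := generalized_tube_lemma hK hK' hW hKW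
  exact ⟨h, hh, U ∩ Ω, inter_subset_right, U' ∩ Ω', inter_subset_right, hU.inter hΩ,
    hU'.inter hΩ', subset_inter hKU hKΩ, subset_inter hKU' hKΩ',
    fun x hx y hy => hWe _ (hUW ⟨hx.1, hy.1⟩)⟩

/-- `S` is bounded by `C` times the `C^j` seminorm on `K` on the smooth functions on `Ω`. -/
def IsSeminormBounded (Ω K : Set F) (j : ℕ) (C : ℝ) (S : (F → ℂ) →ₗ[ℂ] ℂ) : Prop :=
  ∀ f, ContDiffOn ℝ (⊤ : ℕ∞) f Ω → ∀ B, 0 ≤ B →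
    (∀ x ∈ K, ∀ i ≤ j, ‖iteratedFDeriv ℝ i f x‖ ≤ B) → ‖S f‖ ≤ C * B

variable {j : ℕ} {C : ℝ} {S : (F → ℂ) →ₗ[ℂ] ℂ}

omit [FiniteDimensional ℝ F] in
theorem IsSeminormBounded.apply_congr (hS : IsSeminormBounded Ω' K' j C S) {f g : F → ℂ}
    (hf : ContDiffOn ℝ (⊤ : ℕ∞) f Ω') (hg : ContDiffOn ℝ (⊤ : ℕ∞) g Ω') {U : Set F}
    (hU : IsOpen U) (hKU : K' ⊆ U) (hfg : ∀ y ∈ U, f y = g y) : S f = S g := by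
  have h := hS (f - g) (hf.sub hg) 0 le_rfl fun x hx i _ => by
    have he : f - g =ᶠ[𝓝 x] fun _ => 0 := by
      filter_upwards [hU.mem_nhds (hKU hx)] with y hy
      simp [hfg y hy]
    rw [(he.iteratedFDeriv ℝ i).eq_of_nhds]
    simp
  rw [mul_zero, map_sub] at h
  exact sub_eq_zero.1 (norm_le_zero_iff.1 h)

variable {k : E × F → ℂ}

omit [FiniteDimensional ℝ E] [FiniteDimensional ℝ F] in
theorem contDiffOn_slice (hk : ContDiffOn ℝ (⊤ : ℕ∞) k (Ω ×ˢ Ω')) {x : E} (hx : x ∈ Ω) :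
    ContDiffOn ℝ (⊤ : ℕ∞) (fun y => k (x, y)) Ω' :=
  hk.comp (contDiff_const.prodMk contDiff_id).contDiffOn fun _ hy => ⟨hx, hy⟩

omit [FiniteDimensional ℝ E] [FiniteDimensional ℝ F] in
theorem iteratedFDeriv_eq_of_eq_on_prod {h : E × F → ℂ} {U : Set E} {U' : Set F} (hU : IsOpen U)
    (hU' : IsOpen U') (hkh : ∀ x ∈ U, ∀ y ∈ U', k (x, y) = h (x, y)) {x : E} {y : F} (hx : x ∈ U)
    (hy : y ∈ U') (i : ℕ) : iteratedFDeriv ℝ i h (x, y) = iteratedFDeriv ℝ i k (x, y) := by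
  have he : h =ᶠ[𝓝 (x, y)] k := by
    filter_upwards [(hU.prod hU').mem_nhds ⟨hx, hy⟩] with p hp
    exact (hkh _ hp.1 _ hp.2).symm
  exact (he.iteratedFDeriv ℝ i).eq_of_nhds

theorem IsSeminormBounded.contDiffAt_apply_slice (hS : IsSeminormBounded Ω' K' j C S) (hC : 0 ≤ C)
    (hΩ : IsOpen Ω) (hΩ' : IsOpen Ω') (hK' : IsCompact K') (hKΩ' : K' ⊆ Ω')
    (hk : ContDiffOn ℝ (⊤ : ℕ∞) k (Ω ×ˢ Ω')) {x : E} (hx : x ∈ Ω) :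
    ContDiffAt ℝ (⊤ : ℕ∞) (fun x => S fun y => k (x, y)) x ∧
      ∀ (i : ℕ) (B : ℝ), 0 ≤ B →
        (∀ y ∈ K', ∀ l ≤ j, ‖iteratedFDeriv ℝ (i + l) k (x, y)‖ ≤ B) →
          ‖iteratedFDeriv ℝ i (fun x => S fun y => k (x, y)) x‖ ≤ C * B := by
  have : CompactSpace K' := isCompact_iff_compactSpace.1 hK'
  obtain ⟨h, hh, U, hUΩ, U', -, hU, hU', hKU, hKU', hkh⟩ := exists_contDiff_eq_on_prod hΩ hΩ'
    isCompact_singleton (singleton_subset_iff.2 hx) hK' hKΩ' hk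
  have hxU : x ∈ U := hKU rfl
  have he : (fun x => S fun y => k (x, y)) =ᶠ[𝓝 x] fun x => S fun y => h (x, y) := by
    filter_upwards [hU.mem_nhds hxU] with z hz
    exact hS.apply_congr (contDiffOn_slice hk (hUΩ hz))
      (contDiffOn_slice (Ω := univ) hh.contDiffOn trivial) hU' hKU' (hkh z hz)
  obtain ⟨h1, h2⟩ := contDiff_apply_slice hC (fun f hf => hS f hf.contDiffOn) hh
  refine ⟨h1.contDiffAt.congr_of_eventuallyEq he, fun i B hB hkB => ?_⟩
  rw [(he.iteratedFDeriv ℝ i).eq_of_nhds]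
  refine h2 i x B hB fun y hy l hl => ?_
  rw [iteratedFDeriv_eq_of_eq_on_prod hU hU' hkh hxU (hKU' hy)]
  exact hkB y hy l hl

variable [MeasurableSpace E] [BorelSpace E] {μ : Measure E} [IsFiniteMeasureOnCompacts μ]
  {u : E → ℂ}

omit [NormedSpace ℝ E] [FiniteDimensional ℝ E] [BorelSpace E] [IsFiniteMeasureOnCompacts μ] in
theorem integral_mul_eq_setIntegral_of_tsupport_subset (huL : tsupport u ⊆ L) {f g : E → ℂ}
    (hL : MeasurableSet L) (hfg : ∀ x ∈ L, f x = g x) :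
    ∫ x, f x * u x ∂μ = ∫ x in L, g x * u x ∂μ := by
  rw [← setIntegral_eq_integral_of_forall_compl_eq_zero (s := L) fun x hx => by
    rw [image_eq_zero_of_notMem_tsupport fun h => hx (huL h), mul_zero]]
  exact setIntegral_congr_fun hL fun x hx => by simp only [hfg x hx]

theorem contDiffAt_integral_mul (hΩ : IsOpen Ω) (hΩ' : IsOpen Ω') (hL : IsCompact L)
    (hLΩ : L ⊆ Ω) (hu : ContinuousOn u L) (huL : tsupport u ⊆ L)
    (hk : ContDiffOn ℝ (⊤ : ℕ∞) k (Ω ×ˢ Ω')) {y : F} (hy : y ∈ Ω') :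
    ContDiffAt ℝ (⊤ : ℕ∞) (fun y => ∫ x, k (x, y) * u x ∂μ) y ∧
      ∀ (i : ℕ) (B : ℝ), 0 ≤ B → (∀ x ∈ L, ‖iteratedFDeriv ℝ i k (x, y)‖ ≤ B) →
        ‖iteratedFDeriv ℝ i (fun y => ∫ x, k (x, y) * u x ∂μ) y‖ ≤ B * ∫ x in L, ‖u x‖ ∂μ := by
  obtain ⟨h, hh, U, -, U', -, hU, hU', hKU, hKU', hkh⟩ := exists_contDiff_eq_on_prod hΩ hΩ'
    hL hLΩ isCompact_singleton (singleton_subset_iff.2 hy) hk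
  have hyU : y ∈ U' := hKU' rfl
  have hui : IntegrableOn u L μ := hu.integrableOn_compact hL
  have he : (fun y => ∫ x, k (x, y) * u x ∂μ) =ᶠ[𝓝 y] fun y => ∫ x in L, h (x, y) * u x ∂μ := by
    filter_upwards [hU'.mem_nhds hyU] with z hz
    exact integral_mul_eq_setIntegral_of_tsupport_subset huL hL.isClosed.measurableSet
      fun x hx => hkh x (hKU hx) z hz
  refine ⟨(contDiff_setIntegral_mul hL hui hh).1.contDiffAt.congr_of_eventuallyEq he,
    fun i B hB hkB => ?_⟩
  rw [(he.iteratedFDeriv ℝ i).eq_of_nhds]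
  refine norm_iteratedFDeriv_setIntegral_mul_le hL hui hh hB fun x hx => ?_
  rw [iteratedFDeriv_eq_of_eq_on_prod hU hU' hkh (hKU hx) hyU]
  exact hkB x hx

theorem IsSeminormBounded.apply_integral_mul (hS : IsSeminormBounded Ω' K' j C S) (hC : 0 ≤ C)
    (hΩ : IsOpen Ω) (hΩ' : IsOpen Ω') (hK' : IsCompact K') (hKΩ' : K' ⊆ Ω') (hL : IsCompact L)
    (hLΩ : L ⊆ Ω) (hu : ContinuousOn u L) (huL : tsupport u ⊆ L)
    (hk : ContDiffOn ℝ (⊤ : ℕ∞) k (Ω ×ˢ Ω')) :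
    (S fun y => ∫ x, k (x, y) * u x ∂μ) = ∫ x, (S fun y => k (x, y)) * u x ∂μ := by
  have : CompactSpace K' := isCompact_iff_compactSpace.1 hK'
  obtain ⟨h, hh, U, hUΩ, U', -, -, hU', hKU, hKU', hkh⟩ := exists_contDiff_eq_on_prod hΩ hΩ'
    hL hLΩ hK' hKΩ' hk
  have hLm : MeasurableSet L := hL.isClosed.measurableSet
  have hF : ContDiffOn ℝ (⊤ : ℕ∞) (fun y => ∫ x, k (x, y) * u x ∂μ) Ω' := fun y hy =>
    (contDiffAt_integral_mul hΩ hΩ' hL hLΩ hu huL hk hy).1.contDiffWithinAt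
  rw [hS.apply_congr hF (contDiff_setIntegral_mul (μ := μ) hL (hu.integrableOn_compact hL)
      hh).1.contDiffOn hU' hKU' fun y hy =>
        integral_mul_eq_setIntegral_of_tsupport_subset huL hLm fun x hx => hkh x (hKU hx) y hy,
    apply_setIntegral_mul hL hu hC (fun f hf => hS f hf.contDiffOn) hh]
  exact (integral_mul_eq_setIntegral_of_tsupport_subset huL hLm fun x hx =>
    hS.apply_congr (contDiffOn_slice hk (hLΩ hx))
      (contDiffOn_slice (Ω := univ) hh.contDiffOn trivial) hU' hKU' (hkh x (hKU hx))).symm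

end Localization

theorem Colombeau.IsModerate.exists_bound_forall_le {E : Type} [NormedAddCommGroup E]
    [NormedSpace ℝ E] {Ω : Set E} {u : ℝ → E → ℂ} (hu : IsModerate Ω u) {K : Set E}
    (hK : IsCompact K) (hKΩ : K ⊆ Ω) (m : ℕ) :
    ∃ N : ℕ, ∃ c > 0, ∃ η ∈ Ioc (0 : ℝ) 1, ∀ ε ∈ Ioc (0 : ℝ) η, ∀ x ∈ K, ∀ i ≤ m,
      ‖iteratedFDeriv ℝ i (u ε) x‖ ≤ c * ε ^ (-(N : ℝ)) := by
  induction m with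
  | zero =>
    obtain ⟨N, c, hc, η, hη, h⟩ := hu.2 K hK hKΩ 0
    exact ⟨N, c, hc, η, hη, fun ε hε x hx i hi => by
      rw [Nat.le_zero.1 hi]; exact h ε hε x hx⟩
  | succ m ih =>
    obtain ⟨N, c, hc, η, hη, h⟩ := ih
    obtain ⟨N', c', hc', η', hη', h'⟩ := hu.2 K hK hKΩ (m + 1)
    refine ⟨max N N', max c c', lt_max_of_lt_left hc, min η η',
      ⟨lt_min hη.1 hη'.1, min_le_of_left_le hη.2⟩, fun ε hε x hx i hi => ?_⟩
    have hε1 : ε ≤ 1 := (hε.2.trans (min_le_left _ _)).trans hη.2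
    have key : ∀ {M : ℕ} {b : ℝ}, 0 < b → M ≤ max N N' → b ≤ max c c' →
        b * ε ^ (-(M : ℝ)) ≤ max c c' * ε ^ (-((max N N' : ℕ) : ℝ)) := fun hb hM hbc =>
      mul_le_mul hbc (Real.rpow_le_rpow_of_exponent_ge hε.1 hε1
        (neg_le_neg (Nat.cast_le.2 hM))) (Real.rpow_nonneg hε.1.le _) (hb.le.trans hbc)
    rcases hi.lt_or_eq with hi | rfl
    · exact (h ε ⟨hε.1, hε.2.trans (min_le_left _ _)⟩ x hx i (Nat.le_of_lt_succ hi)).trans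
        (key hc (le_max_left _ _) (le_max_left _ _))
    · exact (h' ε ⟨hε.1, hε.2.trans (min_le_right _ _)⟩ x hx).trans
        (key hc' (le_max_right _ _) (le_max_right _ _))

/-- Let `T` be a basic functional in `L(G(Ω),ℂ̃)`.  For every
`k ∈ G(Ω×Ω)` and every `u ∈ G_c(Ω)`,
`T(∫_Ω k(x,·)u(x)dx) = ∫_Ω T(k(x,·))u(x)dx` in `ℂ̃`, where
`∫_Ω k(x,y)u(x)dx ∈ G(Ω)` (in `y`) has representative `y ↦ ∫ k_ε(x,y)u_ε(x)dx`,
`T(k(x,·)) ∈ G(Ω)` has representative `x ↦ T_ε(k_ε(x,·))`, and the right-hand side is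
the generalized number with representative `∫ T_ε(k_ε(x,·))u_ε(x)dx`. -/
theorem statement5
    {n : ℕ} (Ω : Set (Rn n)) (hΩ : IsOpen Ω)
    (T : ℝ → (Rn n → ℂ) →ₗ[ℂ] ℂ) (hT : IsBasicNetE Ω T)
    (k : ℝ → (Rn n × Rn n) → ℂ) (hk : IsModerate (Ω ×ˢ Ω) k)
    (u : ℝ → Rn n → ℂ) (hu : IsModerate Ω u) (huc : HasCmpSupp Ω u) :
    -- `y ↦ ∫ k(x,y) u(x) dx` is a Colombeau function on `Ω`
    IsModerate Ω (fun ε y => ∫ x : Rn n, k ε (x, y) * u ε x) ∧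
    -- `x ↦ T(k(x,·))` is a Colombeau function on `Ω`
    IsModerate Ω (fun ε x => T ε (fun y => k ε (x, y))) ∧
    -- the two generalized numbers coincide in `ℂ̃`
    CIsNegligible (fun ε =>
      T ε (fun y => ∫ x : Rn n, k ε (x, y) * u ε x) -
        ∫ x : Rn n, T ε (fun y => k ε (x, y)) * u ε x) := by
  obtain ⟨L, hL, hLΩ, huL⟩ := huc
  obtain ⟨hTd, K, hK, hKΩ, j, N, η, hη, hTb⟩ := hT
  have hucont : ∀ ε ∈ Ioc (0:ℝ) 1, ContinuousOn (u ε) L := fun ε hε =>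
    (hu.1 ε hε).continuousOn.mono hLΩ
  have hTS : ∀ ε ∈ Ioc (0:ℝ) 1, ∃ K : Set (Rn n), IsCompact K ∧ K ⊆ Ω ∧ ∃ j : ℕ, ∃ C : ℝ,
      0 ≤ C ∧ IsSeminormBounded Ω K j C (T ε) := fun ε hε => by
    obtain ⟨K, hK, hKΩ, j, C, hC, h⟩ := hTd ε hε
    exact ⟨K, hK, hKΩ, j, C, hC, fun f hf B _ hB => h f hf B hB⟩
  have hrpow : ∀ ε : ℝ, 0 < ε → ∀ N N' : ℕ,
      ε ^ (-(N:ℝ)) * ε ^ (-(N':ℝ)) = ε ^ (-((N + N' : ℕ) : ℝ)) := fun ε hε N N' => by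
    rw [← Real.rpow_add hε]
    push_cast
    ring_nf
  refine ⟨⟨fun ε hε y hy => (contDiffAt_integral_mul hΩ hΩ hL hLΩ (hucont ε hε) (huL ε hε)
    (hk.1 ε hε) hy).1.contDiffWithinAt, fun M hM hMΩ i => ?_⟩, ⟨fun ε hε x hx => ?_,
    fun M hM hMΩ i => ?_⟩, fun q => ⟨1, one_pos, 1, ⟨one_pos, le_rfl⟩, fun ε hε => ?_⟩⟩
  · obtain ⟨N₁, c₁, hc₁, η₁, hη₁, hb₁⟩ := hk.2 _ (hL.prod hM) (prod_mono hLΩ hMΩ) i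
    obtain ⟨N₂, c₂, hc₂, η₂, hη₂, hb₂⟩ := hu.2 L hL hLΩ 0
    have hv : 0 ≤ volume.real L := measureReal_nonneg
    refine ⟨N₁ + N₂, c₁ * (c₂ * (volume.real L + 1)), by positivity, min η₁ η₂,
      ⟨lt_min hη₁.1 hη₂.1, min_le_of_left_le hη₁.2⟩, fun ε hε y hy => ?_⟩
    have hε₀ : 0 < ε := hε.1
    have hε₁ : ε ∈ Ioc 0 η₁ := ⟨hε₀, hε.2.trans (min_le_left _ _)⟩
    have hε₂ : ε ∈ Ioc 0 η₂ := ⟨hε₀, hε.2.trans (min_le_right _ _)⟩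
    have hε : ε ∈ Ioc (0:ℝ) 1 := ⟨hε₀, hε₁.2.trans hη₁.2⟩
    have hint : ∫ x in L, ‖u ε x‖ ≤ c₂ * ε ^ (-(N₂:ℝ)) * (volume.real L + 1) := by
      have := norm_setIntegral_le_of_norm_le_const (μ := volume) (f := fun x => ‖u ε x‖)
        (C := c₂ * ε ^ (-(N₂:ℝ))) hL.measure_lt_top fun x hx => by
          rw [norm_norm, ← norm_iteratedFDeriv_zero (𝕜 := ℝ)]
          exact hb₂ ε hε₂ x hx
      refine (Real.le_norm_self _).trans (this.trans ?_)
      gcongr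
      linarith
    refine ((contDiffAt_integral_mul hΩ hΩ hL hLΩ (hucont ε hε) (huL ε hε)
      (hk.1 ε hε) (hMΩ hy)).2 i (c₁ * ε ^ (-(N₁:ℝ))) (by positivity)
        fun x hx => hb₁ ε hε₁ _ ⟨hx, hy⟩).trans ?_
    rw [← hrpow ε hε₀]
    refine (mul_le_mul_of_nonneg_left hint (by positivity)).trans_eq (by ring)
  · obtain ⟨K, hK, hKΩ, j, C, hC, hS⟩ := hTS ε hε
    exact (hS.contDiffAt_apply_slice hC hΩ hΩ hK hKΩ (hk.1 ε hε) hx).1.contDiffWithinAt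
  · obtain ⟨N₁, c, hc, η₁, hη₁, hb⟩ := hk.exists_bound_forall_le (hM.prod hK)
      (prod_mono hMΩ hKΩ) (i + j)
    refine ⟨N + N₁, c, hc, min η η₁, ⟨lt_min hη.1 hη₁.1, min_le_of_left_le hη.2⟩,
      fun ε hε x hx => ?_⟩
    have hε₀ : 0 < ε := hε.1
    have hε₁ : ε ∈ Ioc 0 η := ⟨hε₀, hε.2.trans (min_le_left _ _)⟩
    have hε₂ : ε ∈ Ioc 0 η₁ := ⟨hε₀, hε.2.trans (min_le_right _ _)⟩
    have hS : IsSeminormBounded Ω K j (ε ^ (-(N:ℝ))) (T ε) := hTb ε hε₁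
    refine ((hS.contDiffAt_apply_slice (by positivity) hΩ hΩ hK hKΩ
      (hk.1 ε ⟨hε₀, hε₁.2.trans hη.2⟩) (hMΩ hx)).2 i (c * ε ^ (-(N₁:ℝ))) (by positivity)
        fun y hy l hl => hb ε hε₂ _ ⟨hx, hy⟩ _ (by gcongr)).trans_eq ?_
    rw [← hrpow ε hε₀]
    ring
  · obtain ⟨K, hK, hKΩ, j, C, hC, hS⟩ := hTS ε hε
    beta_reduce
    rw [hS.apply_integral_mul (μ := volume) hC hΩ hΩ hK hKΩ hL hLΩ (hucont ε hε) (huL ε hε) (hk.1 ε hε),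
      sub_self, norm_zero]
    have := hε.1
    positivity
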